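/- Let 0 < b < 1 < a, α ∈ (0,2] with a · b^α = 1. Let q : ℝ → (PMF on ℕ) be a measurable family such that its PGFs G_x(s) = ∑_n (q x)(n) s^n satisfy the semigroup property G_{x+y}(s) = G_x(s) · G_y(s) for all x, y ≥ 0 and s ∈ [0,1], and the discrete semi-stability relation G_x(s) = G_{a·x}(1 - b + b·s) for all x ≥ 0 and s ∈ [0,1]. Let T be a probability measure on ℝ supported on [0,∞) that is semi-selfdecomposable with span b^α, i.e. there exists a probability measure T₀ supported on [0,∞) with T = (Measure.map (fun x => b^α · x) T) ∗ T₀. Define the mixture PMF p by p(n) = ∫ (q x)(n) dT(x). Then p is discrete semi-selfdecomposable with span b: there exists a PMF r on ℕ such that ∑_n p(n) s^n = (∑_n p(n)(1-b+b·s)^n) · (∑_n r(n) s^n) for all s ∈ [0,1]. -/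

import Mathlib

open MeasureTheory Set

lemma ae_nonneg_of_measure_Iio_eq_zero {μ : Measure ℝ} (h : μ (Iio 0) = 0) :
    ∀ᵐ x ∂μ, 0 ≤ x := by
  rw [ae_iff]
  simpa only [not_le, Iio_def] using h

section Mixture

variable {q : ℝ → ℕ → ℝ}

lemma summable_of_tsum_eq_one {f : ℕ → ℝ} (h : ∑' n, f n = 1) : Summable f := by
  by_contra hf
  rw [tsum_eq_zero_of_not_summable hf] at h
  exact zero_ne_one h

lemma pgf_hasSum {f : ℕ → ℝ} (hf : ∀ n, 0 ≤ f n) (hsum : ∑' n, f n = 1)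
    {s : ℝ} (hs : s ∈ Icc (0 : ℝ) 1) :
    HasSum (fun n => f n * s ^ n) (∑' n, f n * s ^ n) :=
  (Summable.of_nonneg_of_le (fun n => mul_nonneg (hf n) (pow_nonneg hs.1 n))
    (fun n => mul_le_of_le_one_right (hf n) (pow_le_one₀ hs.1 hs.2))
    (summable_of_tsum_eq_one hsum)).hasSum

lemma pgf_nonneg {f : ℕ → ℝ} (hf : ∀ n, 0 ≤ f n) {s : ℝ} (hs : 0 ≤ s) :
    0 ≤ ∑' n, f n * s ^ n :=
  tsum_nonneg fun n => mul_nonneg (hf n) (pow_nonneg hs n)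

lemma pgf_le_one {f : ℕ → ℝ} (hf : ∀ n, 0 ≤ f n) (hsum : ∑' n, f n = 1)
    {s : ℝ} (hs : s ∈ Icc (0 : ℝ) 1) : ∑' n, f n * s ^ n ≤ 1 :=
  hsum ▸ (pgf_hasSum hf hsum hs).summable.tsum_le_tsum
    (fun n => mul_le_of_le_one_right (hf n) (pow_le_one₀ hs.1 hs.2))
    (summable_of_tsum_eq_one hsum)

/-- The PGF of a mixture is the mixture of the PGFs. -/
lemma hasSum_integral_pgf
    (hq_meas : ∀ n : ℕ, Measurable fun x => q x n)
    (hq_nonneg : ∀ x : ℝ, 0 ≤ x → ∀ n : ℕ, 0 ≤ q x n)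
    (hq_sum : ∀ x : ℝ, 0 ≤ x → (∑' n : ℕ, q x n) = 1)
    {μ : Measure ℝ} [IsProbabilityMeasure μ] (hμ : ∀ᵐ x ∂μ, 0 ≤ x)
    {s : ℝ} (hs : s ∈ Icc (0 : ℝ) 1) :
    HasSum (fun n => (∫ x, q x n ∂μ) * s ^ n) (∫ x, ∑' n, q x n * s ^ n ∂μ) := by
  simp_rw [← integral_mul_const]
  refine hasSum_integral_of_dominated_convergence (fun n x => q x n)
    (fun n => ((hq_meas n).mul_const _).aestronglyMeasurable) (fun n => ?_) ?_ ?_ ?_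
  · filter_upwards [hμ] with x hx
    rw [Real.norm_of_nonneg (mul_nonneg (hq_nonneg x hx n) (pow_nonneg hs.1 n))]
    exact mul_le_of_le_one_right (hq_nonneg x hx n) (pow_le_one₀ hs.1 hs.2)
  · filter_upwards [hμ] with x hx using summable_of_tsum_eq_one (hq_sum x hx)
  · refine (integrable_const (1 : ℝ)).congr ?_
    filter_upwards [hμ] with x hx using (hq_sum x hx).symm
  · filter_upwards [hμ] with x hx using pgf_hasSum (hq_nonneg x hx) (hq_sum x hx) hs

lemma integrable_pgf
    (hq_meas : ∀ n : ℕ, Measurable fun x => q x n)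
    (hq_nonneg : ∀ x : ℝ, 0 ≤ x → ∀ n : ℕ, 0 ≤ q x n)
    (hq_sum : ∀ x : ℝ, 0 ≤ x → (∑' n : ℕ, q x n) = 1)
    {μ : Measure ℝ} [IsProbabilityMeasure μ] (hμ : ∀ᵐ x ∂μ, 0 ≤ x)
    {s : ℝ} (hs : s ∈ Icc (0 : ℝ) 1) :
    Integrable (fun x => ∑' n, q x n * s ^ n) μ := by
  refine (integrable_const (1 : ℝ)).mono' ?_ ?_
  · refine aestronglyMeasurable_of_tendsto_ae Filter.atTop
      (f := fun N x => ∑ n ∈ Finset.range N, q x n * s ^ n) (fun N => ?_) ?_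
    · exact (Finset.measurable_sum _ fun n _ => (hq_meas n).mul_const _).aestronglyMeasurable
    · filter_upwards [hμ] with x hx using
        (pgf_hasSum (hq_nonneg x hx) (hq_sum x hx) hs).tendsto_sum_nat
  · filter_upwards [hμ] with x hx
    rw [Real.norm_of_nonneg (pgf_nonneg (hq_nonneg x hx) hs.1)]
    exact pgf_le_one (hq_nonneg x hx) (hq_sum x hx) hs

end Mixture

/-- A function multiplicative on `[0, ∞)` has multiplicative integrals under convolution of
measures carried by `[0, ∞)`. -/
lemma integral_conv_of_map_add_eq_mul {G : ℝ → ℝ} {μ ν : Measure ℝ} [SFinite μ] [SFinite ν]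
    (hμ : ∀ᵐ x ∂μ, 0 ≤ x) (hν : ∀ᵐ x ∂ν, 0 ≤ x)
    (hG : ∀ x, 0 ≤ x → ∀ y, 0 ≤ y → G (x + y) = G x * G y)
    (hint : Integrable G (μ.conv ν)) :
    ∫ x, G x ∂(μ.conv ν) = (∫ x, G x ∂μ) * ∫ y, G y ∂ν := by
  rw [integral_conv hint, ← integral_mul_const]
  refine integral_congr_ae ?_
  filter_upwards [hμ] with x hx
  rw [← integral_const_mul]
  refine integral_congr_ae ?_
  filter_upwards [hν] with y hy using hG x hx y hy

/-- Discrete analogue of the subordination result: φ-semi-stable(a,b) PGFs are discrete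
semi-SD(b) if φ is semi-SD(b^α), where `a·b^α = 1`, `α ∈ (0,2]`. Here `q x` is the PMF of
the discrete semi-stable(a,b) convolution semigroup at time `x`, `T` is the directing law on
`[0,∞)`, and the mixture PMF is `p n = ∫ (q x)(n) dT(x)`. -/
theorem phi_semiStable_pgf_discrete_semiSelfdecomposable
    (a b α : ℝ) (hb : 0 < b) (hb1 : b < 1) (ha : 1 < a)
    (hα0 : 0 < α) (hα2 : α ≤ 2) (hab : a * b ^ α = 1)
    (q : ℝ → ℕ → ℝ)
    (hq_meas : ∀ n : ℕ, Measurable fun x => q x n)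
    (hq_nonneg : ∀ x : ℝ, 0 ≤ x → ∀ n : ℕ, 0 ≤ q x n)
    (hq_sum : ∀ x : ℝ, 0 ≤ x → (∑' n : ℕ, q x n) = 1)
    (hq_semigroup : ∀ x : ℝ, 0 ≤ x → ∀ y : ℝ, 0 ≤ y → ∀ s ∈ Icc (0 : ℝ) 1,
      (∑' n : ℕ, q (x + y) n * s ^ n) =
        (∑' n : ℕ, q x n * s ^ n) * ∑' n : ℕ, q y n * s ^ n)
    (hq_semistable : ∀ x : ℝ, 0 ≤ x → ∀ s ∈ Icc (0 : ℝ) 1,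
      (∑' n : ℕ, q x n * s ^ n) = ∑' n : ℕ, q (a * x) n * (1 - b + b * s) ^ n)
    (T : Measure ℝ) [IsProbabilityMeasure T] (hT_supp : T (Iio 0) = 0)
    (hT_ssd : ∃ T₀ : Measure ℝ, IsProbabilityMeasure T₀ ∧ T₀ (Iio 0) = 0 ∧
      T = (Measure.map (fun x => b ^ α * x) T).conv T₀)
    (p : ℕ → ℝ) (hp : ∀ n : ℕ, p n = ∫ x, q x n ∂T) :
    ∃ r : ℕ → ℝ, (∀ n : ℕ, 0 ≤ r n) ∧ (∑' n : ℕ, r n) = 1 ∧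
      ∀ s ∈ Icc (0 : ℝ) 1,
        (∑' n : ℕ, p n * s ^ n) =
          (∑' n : ℕ, p n * (1 - b + b * s) ^ n) * ∑' n : ℕ, r n * s ^ n := by
  obtain ⟨T₀, hT₀, hT₀_supp, hT⟩ := hT_ssd
  have hTae := ae_nonneg_of_measure_Iio_eq_zero hT_supp
  have hT₀ae := ae_nonneg_of_measure_Iio_eq_zero hT₀_supp
  have hc : 0 < b ^ α := Real.rpow_pos_of_pos hb α
  have hmeas : Measurable fun x : ℝ => b ^ α * x := measurable_const_mul _
  have : IsProbabilityMeasure (Measure.map (fun x => b ^ α * x) T) :=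
    Measure.isProbabilityMeasure_map hmeas.aemeasurable
  have hνae : ∀ᵐ x ∂(Measure.map (fun x => b ^ α * x) T), 0 ≤ x := by
    rw [ae_map_iff hmeas.aemeasurable measurableSet_Ici]
    filter_upwards [hTae] with x hx using mul_nonneg hc.le hx
  refine ⟨fun n => ∫ x, q x n ∂T₀, fun n => integral_nonneg_of_ae ?_, ?_, fun s hs => ?_⟩
  · filter_upwards [hT₀ae] with x hx using hq_nonneg x hx n
  · have h := (hasSum_integral_pgf hq_meas hq_nonneg hq_sum hT₀ae
      (right_mem_Icc.2 zero_le_one)).tsum_eq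
    simp only [one_pow, mul_one] at h
    rw [h, integral_congr_ae (g := fun _ => (1 : ℝ))
      (by filter_upwards [hT₀ae] with x hx using hq_sum x hx)]
    simp
  · have hs' : 1 - b + b * s ∈ Icc (0 : ℝ) 1 :=
      ⟨by nlinarith [hs.1], by nlinarith [hs.2]⟩
    simp_rw [hp]
    rw [(hasSum_integral_pgf hq_meas hq_nonneg hq_sum hTae hs).tsum_eq,
      (hasSum_integral_pgf hq_meas hq_nonneg hq_sum hTae hs').tsum_eq,
      (hasSum_integral_pgf hq_meas hq_nonneg hq_sum hT₀ae hs).tsum_eq]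
    have hint := integrable_pgf hq_meas hq_nonneg hq_sum hTae hs
    have hscale : ∫ x, ∑' n, q x n * s ^ n ∂(Measure.map (fun x => b ^ α * x) T) =
        ∫ x, ∑' n, q x n * (1 - b + b * s) ^ n ∂T := by
      rw [integral_map hmeas.aemeasurable
        (integrable_pgf hq_meas hq_nonneg hq_sum hνae hs).aestronglyMeasurable]
      refine integral_congr_ae ?_
      filter_upwards [hTae] with x hx
      rw [hq_semistable _ (mul_nonneg hc.le hx) s hs, ← mul_assoc, hab, one_mul]
    rw [← hscale, ← integral_conv_of_map_add_eq_mul hνae hT₀ae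
      (fun x hx y hy => hq_semigroup x hx y hy s hs) (hT ▸ hint), ← hT]
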